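/- Comparison principle for the continuous biharmonic operator: if u : [0,1] → ℝ is four times continuously differentiable with u(0) = u′(0) = u(1) = u′(1) = 0, and its fourth derivative satisfies u⁗(x) ≥ 0 for all x ∈ [0,1], then u(x) ≥ 0 for all x ∈ [0,1]. -/

import Mathlib

open Set

/-- Rolle's theorem for a function that is differentiable everywhere. -/
lemma exists_deriv_eq_zero_of_hasDerivAt {f f' : ℝ → ℝ} (hf : ∀ t, HasDerivAt f (f' t) t)
    {a b : ℝ} (hab : a < b) (ha : f a = 0) (hb : f b = 0) : ∃ c ∈ Ioo a b, f' c = 0 :=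
  exists_hasDerivAt_eq_zero hab (fun t _ => (hf t).continuousAt.continuousWithinAt)
    (ha.trans hb.symm) fun t _ => hf t

/-- A function with double zeros at `a` and `b` and a further zero in between has a zero of its
fourth derivative. -/
lemma exists_fourth_deriv_eq_zero {f f₁ f₂ f₃ f₄ : ℝ → ℝ}
    (hf : ∀ t, HasDerivAt f (f₁ t) t) (hf₁ : ∀ t, HasDerivAt f₁ (f₂ t) t)
    (hf₂ : ∀ t, HasDerivAt f₂ (f₃ t) t) (hf₃ : ∀ t, HasDerivAt f₃ (f₄ t) t)
    {a x b : ℝ} (hax : a < x) (hxb : x < b) (ha : f a = 0) (ha' : f₁ a = 0) (hx : f x = 0)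
    (hb : f b = 0) (hb' : f₁ b = 0) : ∃ c ∈ Ioo a b, f₄ c = 0 := by
  obtain ⟨p, ⟨hp, hp'⟩, hp0⟩ := exists_deriv_eq_zero_of_hasDerivAt hf hax ha hx
  obtain ⟨q, ⟨hq, hq'⟩, hq0⟩ := exists_deriv_eq_zero_of_hasDerivAt hf hxb hx hb
  obtain ⟨r, ⟨hr, hr'⟩, hr0⟩ := exists_deriv_eq_zero_of_hasDerivAt hf₁ hp ha' hp0
  obtain ⟨s, ⟨hs, hs'⟩, hs0⟩ :=
    exists_deriv_eq_zero_of_hasDerivAt hf₁ (hp'.trans hq) hp0 hq0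
  obtain ⟨t, ⟨ht, ht'⟩, ht0⟩ := exists_deriv_eq_zero_of_hasDerivAt hf₁ hq' hq0 hb'
  obtain ⟨y, ⟨hy, hy'⟩, hy0⟩ :=
    exists_deriv_eq_zero_of_hasDerivAt hf₂ (hr'.trans hs) hr0 hs0
  obtain ⟨z, ⟨hz, hz'⟩, hz0⟩ :=
    exists_deriv_eq_zero_of_hasDerivAt hf₂ (hs'.trans ht) hs0 ht0
  obtain ⟨c, ⟨hc, hc'⟩, hc0⟩ :=
    exists_deriv_eq_zero_of_hasDerivAt hf₃ (hy'.trans hz) hy0 hz0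
  exact ⟨c, ⟨by linarith, by linarith⟩, hc0⟩

/-- Comparison principle for the continuous biharmonic operator: if `u` is four times
continuously differentiable with clamped boundary conditions
`u(0) = u'(0) = u(1) = u'(1) = 0` and `u⁗ ≥ 0` on `[0,1]`, then `u ≥ 0` on `[0,1]`. -/
theorem biharmonic_comparison_principle
    (u : ℝ → ℝ) (hu : ContDiff ℝ 4 u)
    (h0 : u 0 = 0) (h0' : deriv u 0 = 0) (h1 : u 1 = 0) (h1' : deriv u 1 = 0)
    (hpos : ∀ x ∈ Set.Icc (0:ℝ) 1, 0 ≤ iteratedDeriv 4 u x) :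
    ∀ x ∈ Set.Icc (0:ℝ) 1, 0 ≤ u x := by
  rintro x ⟨hx0, hx1⟩
  rcases hx0.eq_or_lt with rfl | hx0
  · exact h0.ge
  rcases hx1.eq_or_lt with rfl | hx1
  · exact h1.ge
  have hD (k : ℕ) (hk : (k : WithTop ℕ∞) < 4) (t : ℝ) :
      HasDerivAt (iteratedDeriv k u) (iteratedDeriv (k + 1) u t) t := by
    rw [iteratedDeriv_succ]
    exact (hu.differentiable_iteratedDeriv k hk t).hasDerivAt
  have hP (c₀ c₁ c₂ c₃ c₄ t : ℝ) :
      HasDerivAt (fun t => c₀ + c₁ * t + c₂ * t ^ 2 + c₃ * t ^ 3 + c₄ * t ^ 4)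
        (c₁ + 2 * c₂ * t + 3 * c₃ * t ^ 2 + 4 * c₄ * t ^ 3 + 0 * t ^ 4) t := by
    refine HasDerivAt.congr_deriv ((((((hasDerivAt_id t).const_mul c₁).const_add c₀).add
      ((hasDerivAt_pow 2 t).const_mul c₂)).add ((hasDerivAt_pow 3 t).const_mul c₃)).add
      ((hasDerivAt_pow 4 t).const_mul c₄)) ?_
    norm_num
    ring
  have hpx : 0 < x ^ 2 * (1 - x) ^ 2 := by
    have : 0 < 1 - x := by linarith
    positivity
  -- Compare `u` with the multiple of `t² (1 - t)²` that agrees with it at `x`.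
  obtain ⟨c, hc⟩ : ∃ c, u x = c * (x ^ 2 * (1 - x) ^ 2) := ⟨_, (div_mul_cancel₀ _ hpx.ne').symm⟩
  obtain ⟨y, hy, hy0⟩ := exists_fourth_deriv_eq_zero
    (fun t => (hD 0 (by norm_num) t).sub ((hP 0 0 1 (-2) 1 t).const_mul c))
    (fun t => (hD 1 (by norm_num) t).sub ((hP _ _ _ _ _ t).const_mul c))
    (fun t => (hD 2 (by norm_num) t).sub ((hP _ _ _ _ _ t).const_mul c))
    (fun t => (hD 3 (by norm_num) t).sub ((hP _ _ _ _ _ t).const_mul c))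
    hx0 hx1 (by simp [h0]) (by simp [h0'])
    (by simp only [Pi.sub_apply, iteratedDeriv_zero, hc]; ring)
    (by simp [h1]; norm_num) (by simp [h1']; norm_num)
  have hy4 := hpos y (Ioo_subset_Icc_self hy)
  have hcpos : 0 ≤ c := by
    norm_num at hy0
    linarith
  rw [hc]
  positivity
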